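/- In the clipping ANN setting, assume Lip(f) < min_{i ∈ {1,…,h}} v_i w_i, let θ ∈ ℝ^{h+1} satisfy (∇L)(θ) = 0, let ε, δ ∈ (0, ∞) satisfy ε − δ > 2 [min_{j ∈ {1,…,h}} w_j]^{−1} and inf_{x ∈ [a+δ, b−δ]} p(x) ≥ [min_{j ∈ {1,…,h}} w_j]^{−1} Lip(p), assume that p restricted to [a, a+ε] is strictly increasing and p restricted to [b−ε, b] is strictly decreasing, and assume that θ is not a descending critical point of L. Then for every x ∈ (a, b) with {j ∈ {1,…,h} : x ∈ I_j^θ} ≠ ∅ it holds that Σ_{j ∈ {1,…,h}, x ∈ I_j^θ} v_j w_j ≤ 4 max_{j ∈ {1,…,h}, x ∈ I_j^θ} v_j w_j. -/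

import Mathlib

open MeasureTheory Filter

noncomputable section

/-- The clipping function `x ↦ min{max{x,0},1}`. -/
def clipFn (x : ℝ) : ℝ := min (max x 0) 1

/-- `ψ_i(θ) = -θ_i / w_i`. -/
def psiC {h : ℕ} (w : Fin h → ℝ) (θ : Fin (h + 1) → ℝ) (i : Fin h) : ℝ :=
  -θ i.castSucc / w i

/-- The activity interval `I_i^θ = (ψ_i(θ), ψ_i(θ) + 1/w_i) ∩ (a, b)`. -/
def actI {h : ℕ} (a b : ℝ) (w : Fin h → ℝ) (θ : Fin (h + 1) → ℝ) (i : Fin h) : Set ℝ :=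
  Set.Ioo (psiC w θ i) (psiC w θ i + (w i)⁻¹) ∩ Set.Ioo a b

/-- The realization function `N^θ(x) = θ_{h+1} + ∑_i v_i c(w_i x + θ_i)`. -/
def realC {h : ℕ} (v w : Fin h → ℝ) (θ : Fin (h + 1) → ℝ) (x : ℝ) : ℝ :=
  θ (Fin.last h) + ∑ i : Fin h, v i * clipFn (w i * x + θ i.castSucc)

/-- The risk `L(θ) = ∫_a^b (N^θ(x) - f(x))² p(x) dx`. -/
def riskC {h : ℕ} (a b : ℝ) (v w : Fin h → ℝ) (f p : ℝ → ℝ) (θ : Fin (h + 1) → ℝ) : ℝ :=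
  ∫ x in Set.Ioo a b, (realC v w θ x - f x) ^ 2 * p x

/-- The gradient `∇L(θ)` as a vector of partial derivatives. -/
def gradC {h : ℕ} (a b : ℝ) (v w : Fin h → ℝ) (f p : ℝ → ℝ) (θ : Fin (h + 1) → ℝ) :
    Fin (h + 1) → ℝ :=
  fun k => fderiv ℝ (riskC a b v w f p) θ (Pi.single k 1)

/-- `x` is a descending critical point of `g` : `∇g(x) = 0` and the Hessian quadratic form
admits a negative value. -/
def IsDescCrit {n : ℕ} (g : (Fin n → ℝ) → ℝ) (x : Fin n → ℝ) : Prop :=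
  fderiv ℝ g x = 0 ∧ ∃ u : Fin n → ℝ, iteratedFDeriv ℝ 2 g x ![u, u] < 0

/-- The Euclidean norm on `Fin n → ℝ`. -/
def euclNorm {n : ℕ} (x : Fin n → ℝ) : ℝ := Real.sqrt (∑ i, (x i) ^ 2)

/-- Piecewise polynomial functions. -/
def PiecewisePoly (F : ℝ → ℝ) : Prop :=
  ∃ (K : ℕ) (τ : ℕ → EReal), 0 < K ∧ τ 0 = ⊥ ∧ τ K = ⊤ ∧
    (∀ k, k < K → τ k < τ (k + 1)) ∧
    ∀ k, k < K → ∃ q : Polynomial ℝ, ∀ x : ℝ,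
      τ k < (x : EReal) → (x : EReal) < τ (k + 1) → F x = q.eval x

theorem continuous_clipFn : Continuous clipFn := by
  unfold clipFn
  fun_prop

theorem monotone_clipFn : Monotone clipFn := fun _ _ hxy =>
  min_le_min (max_le_max hxy le_rfl) le_rfl

theorem abs_clipFn_sub_le (x y : ℝ) : |clipFn x - clipFn y| ≤ |x - y| :=
  (abs_min_sub_min_le_max _ _ _ _).trans <| by
    simpa using abs_max_sub_max_le_max x 0 y 0

theorem clipFn_of_mem {x : ℝ} (hx : x ∈ Set.Icc 0 1) : clipFn x = x := by
  simp [clipFn, hx.1, hx.2]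

theorem hasDerivAt_clipFn {x : ℝ} (h0 : x ≠ 0) (h1 : x ≠ 1) :
    HasDerivAt clipFn ((Set.Ioo (0 : ℝ) 1).indicator 1 x) x := by
  rcases lt_or_gt_of_ne h0 with h0 | h0
  · rw [Set.indicator_of_notMem (fun hx => absurd hx.1 (by linarith))]
    refine (hasDerivAt_const x (0 : ℝ)).congr_of_eventuallyEq ?_
    filter_upwards [Iio_mem_nhds h0] with y hy
    simp [clipFn, max_eq_right (show y ≤ 0 from le_of_lt hy)]
  rcases lt_or_gt_of_ne h1 with h1 | h1
  · rw [Set.indicator_of_mem (Set.mem_Ioo.2 ⟨h0, h1⟩)]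
    refine (hasDerivAt_id x).congr_of_eventuallyEq ?_
    filter_upwards [Ioo_mem_nhds h0 h1] with y hy
    exact clipFn_of_mem (Set.Ioo_subset_Icc_self hy)
  · rw [Set.indicator_of_notMem (fun hx => absurd hx.2 (by linarith))]
    refine (hasDerivAt_const x (1 : ℝ)).congr_of_eventuallyEq ?_
    filter_upwards [Ioi_mem_nhds h1] with y hy
    exact min_eq_right (le_trans (le_of_lt hy) (le_max_left _ _))

theorem hasDerivAt_integral_clipFn {w : ℝ} (hw : 0 < w) (τ s t : ℝ) {q : ℝ → ℝ}
    (hq : Continuous q) :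
    HasDerivAt (fun τ => ∫ x in s..t, clipFn (w * x + τ) * q x)
      (∫ x in s..t, (Set.Ioo (-τ / w) (-τ / w + w⁻¹)).indicator q x) τ := by
  have hc : ∀ τ, Continuous fun x => clipFn (w * x + τ) * q x := fun τ =>
    (continuous_clipFn.comp (by fun_prop)).mul hq
  refine (intervalIntegral.hasDerivAt_integral_of_dominated_loc_of_lip
    (bound := fun x => |q x|) Filter.univ_mem
    (Eventually.of_forall fun τ => (hc τ).aestronglyMeasurable)
    ((hc τ).intervalIntegrable _ _)
    (hq.stronglyMeasurable.indicator measurableSet_Ioo).aestronglyMeasurable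
    (Eventually.of_forall fun x _ => ?_) (hq.abs.intervalIntegrable _ _) ?_).2
  · refine LipschitzOnWith.of_dist_le_mul fun τ₁ _ τ₂ _ => ?_
    rw [Real.dist_eq, Real.dist_eq, ← sub_mul, abs_mul, mul_comm]
    refine mul_le_mul ?_ ?_ (abs_nonneg _) (NNReal.coe_nonneg _)
    · simp
    · exact (abs_clipFn_sub_le _ _).trans_eq (by ring_nf)
  · have h0 : ∀ᵐ x : ℝ, x ≠ -τ / w := by simp [ae_iff]
    have h1 : ∀ᵐ x : ℝ, x ≠ -τ / w + w⁻¹ := by simp [ae_iff]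
    filter_upwards [h0, h1] with x hx0 hx1 _
    have e0 : -τ / w = (0 - τ) / w := by ring
    have e1 : -τ / w + w⁻¹ = (1 - τ) / w := by field_simp; ring
    rw [e0, ne_eq, eq_div_iff hw.ne'] at hx0
    rw [e1, ne_eq, eq_div_iff hw.ne'] at hx1
    have hd := ((hasDerivAt_clipFn (x := w * x + τ) (fun h => hx0 (by linarith))
      (fun h => hx1 (by linarith))).comp τ
        ((hasDerivAt_id τ).const_add (w * x))).mul_const (q x)
    refine hd.congr_deriv ?_
    rw [e1, e0]
    by_cases hx : x ∈ Set.Ioo ((0 - τ) / w) ((1 - τ) / w)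
    · rw [Set.indicator_of_mem hx, Set.indicator_of_mem]
      · simp
      · rw [Set.mem_Ioo, div_lt_iff₀ hw, lt_div_iff₀ hw] at hx
        constructor <;> linarith [hx.1, hx.2]
    · rw [Set.indicator_of_notMem hx, Set.indicator_of_notMem]
      · simp
      · rw [Set.mem_Ioo, div_lt_iff₀ hw, lt_div_iff₀ hw] at hx
        exact fun h => hx ⟨by linarith [h.1], by linarith [h.2]⟩

theorem continuous_realC {h : ℕ} (v w : Fin h → ℝ) (θ : Fin (h + 1) → ℝ) :
    Continuous (realC v w θ) := by
  have := continuous_clipFn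
  unfold realC
  fun_prop

theorem abs_realC_sub_le {h : ℕ} (v w : Fin h → ℝ) (θ θ' : Fin (h + 1) → ℝ) (x : ℝ) :
    |realC v w θ' x - realC v w θ x| ≤ (1 + ∑ i, |v i|) * ‖θ' - θ‖ := by
  have hk : ∀ k, |θ' k - θ k| ≤ ‖θ' - θ‖ := fun k => by
    simpa using norm_le_pi_norm (θ' - θ) k
  have e : realC v w θ' x - realC v w θ x = (θ' (Fin.last h) - θ (Fin.last h)) +
      ∑ i, v i * (clipFn (w i * x + θ' i.castSucc) - clipFn (w i * x + θ i.castSucc)) := by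
    simp only [realC, mul_sub, Finset.sum_sub_distrib]
    ring
  rw [e, add_mul, one_mul, Finset.sum_mul]
  refine (abs_add_le _ _).trans (add_le_add (hk _) ((Finset.abs_sum_le_sum_abs _ _).trans
    (Finset.sum_le_sum fun i _ => ?_)))
  rw [abs_mul]
  refine mul_le_mul_of_nonneg_left ((abs_clipFn_sub_le _ _).trans ?_) (abs_nonneg _)
  simpa using hk i.castSucc

/-- The `k`-th coordinate functional. -/
abbrev coordL {n : ℕ} (k : Fin n) : (Fin n → ℝ) →L[ℝ] ℝ :=
  ContinuousLinearMap.proj k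

theorem hasFDerivAt_integral_realC {h : ℕ} (v w : Fin h → ℝ) (hw : ∀ i, 0 < w i)
    (θ : Fin (h + 1) → ℝ) (s t : ℝ) {q : ℝ → ℝ} (hq : Continuous q) :
    HasFDerivAt (fun θ' => ∫ x in s..t, realC v w θ' x * q x)
      ((∫ x in s..t, q x) • coordL (Fin.last h) + ∑ i, (v i * ∫ x in s..t,
        (Set.Ioo (psiC w θ i) (psiC w θ i + (w i)⁻¹)).indicator q x) • coordL i.castSucc) θ := by
  have hc : ∀ (i : Fin h) (τ : ℝ), Continuous fun x => clipFn (w i * x + τ) * q x :=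
    fun i τ => (continuous_clipFn.comp (by fun_prop)).mul hq
  have e : (fun θ' : Fin (h + 1) → ℝ => ∫ x in s..t, realC v w θ' x * q x) = fun θ' =>
      θ' (Fin.last h) * (∫ x in s..t, q x) +
        ∑ i, v i * ∫ x in s..t, clipFn (w i * x + θ' i.castSucc) * q x := by
    funext θ'
    simp only [realC, add_mul, Finset.sum_mul, mul_assoc]
    rw [intervalIntegral.integral_add ((hq.const_mul _).intervalIntegrable _ _),
      intervalIntegral.integral_const_mul, intervalIntegral.integral_finsetSum]
    · simp only [intervalIntegral.integral_const_mul]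
    · exact fun i _ => ((hc i _).const_mul _).intervalIntegrable _ _
    · exact (continuous_finsetSum _ fun i _ => (hc i _).const_mul _).intervalIntegrable _ _
  rw [e]
  refine HasFDerivAt.add ?_ (HasFDerivAt.fun_sum fun i _ => ?_)
  · exact (coordL (Fin.last h)).hasFDerivAt.mul_const _
  · have := ((hasDerivAt_integral_clipFn (hw i) (θ i.castSucc) s t hq).comp_hasFDerivAt θ
      (coordL i.castSucc).hasFDerivAt).const_mul (v i)
    rw [smul_smul] at this
    exact this

theorem hasFDerivAt_zero_of_abs_le_sq {n : ℕ} {e : (Fin n → ℝ) → ℝ} {θ : Fin n → ℝ} {C : ℝ}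
    (he : ∀ θ', |e θ'| ≤ C * ‖θ' - θ‖ ^ 2) : HasFDerivAt e (0 : (Fin n → ℝ) →L[ℝ] ℝ) θ := by
  refine Asymptotics.IsBigO.hasFDerivAt (n := 2) (Asymptotics.IsBigO.of_bound C ?_) one_lt_two
  filter_upwards with θ'
  simpa using he θ'

/-- The integrand of the gradient of the risk. -/
def residC {h : ℕ} (v w : Fin h → ℝ) (f p : ℝ → ℝ) (θ : Fin (h + 1) → ℝ) (x : ℝ) : ℝ :=
  (realC v w θ x - f x) * p x

theorem continuous_residC {h : ℕ} (v w : Fin h → ℝ) {f p : ℝ → ℝ} (hf : Continuous f)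
    (hp : Continuous p) (θ : Fin (h + 1) → ℝ) : Continuous (residC v w f p θ) :=
  ((continuous_realC v w θ).sub hf).mul hp

theorem riskC_eq_intervalIntegral {h : ℕ} {a b : ℝ} (hab : a < b) (v w : Fin h → ℝ)
    (f p : ℝ → ℝ) (θ : Fin (h + 1) → ℝ) :
    riskC a b v w f p θ = ∫ x in a..b, (realC v w θ x - f x) ^ 2 * p x := by
  rw [riskC, intervalIntegral.integral_of_le hab.le, integral_Ioc_eq_integral_Ioo]

theorem intervalIntegral_indicator_Ioo {a b α β : ℝ} (hab : a ≤ b) (hαβ : α ≤ β) {q : ℝ → ℝ}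
    (hq : ∀ x ∉ Set.Ioo a b, q x = 0) :
    ∫ x in a..b, (Set.Ioo α β).indicator q x = ∫ x in α..β, q x := by
  rw [intervalIntegral.integral_of_le hab, intervalIntegral.integral_of_le hαβ,
    integral_Ioc_eq_integral_Ioo, integral_Ioc_eq_integral_Ioo,
    ← integral_indicator measurableSet_Ioo, ← integral_indicator measurableSet_Ioo]
  congr 1
  funext x
  by_cases hx : x ∈ Set.Ioo a b
  · rw [Set.indicator_of_mem hx]
  · rw [Set.indicator_of_notMem hx, Set.indicator_apply, hq x hx, ite_self]

theorem hasFDerivAt_riskC {h : ℕ} {a b : ℝ} (hab : a < b) (v w : Fin h → ℝ)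
    (hw : ∀ i, 0 < w i) {f p : ℝ → ℝ} (hf : Continuous f) (hp : Continuous p)
    (hp0 : ∀ x ∉ Set.Ioo a b, p x = 0) {P : ℝ} (hP : ∀ x, |p x| ≤ P)
    (θ : Fin (h + 1) → ℝ) :
    HasFDerivAt (riskC a b v w f p)
      ((2 * ∫ x in a..b, residC v w f p θ x) • coordL (Fin.last h) +
        ∑ i, (2 * v i * ∫ x in psiC w θ i..psiC w θ i + (w i)⁻¹, residC v w f p θ x) •
          coordL i.castSucc) θ := by
  set C := 1 + ∑ i, |v i| with hC
  have hN := continuous_realC v w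
  have hr := continuous_residC v w hf hp θ
  have hr0 : ∀ x ∉ Set.Ioo a b, residC v w f p θ x = 0 := fun x hx => by
    simp [residC, hp0 x hx]
  have hT := (hasFDerivAt_integral_realC v w hw θ a b hr).const_mul 2
  have hE : HasFDerivAt
      (fun θ' => ∫ x in a..b, (realC v w θ' x - realC v w θ x) ^ 2 * p x)
      (0 : (Fin (h + 1) → ℝ) →L[ℝ] ℝ) θ := by
    refine hasFDerivAt_zero_of_abs_le_sq (C := C ^ 2 * P * |b - a|) fun θ' => ?_
    have hb : ∀ x, ‖(realC v w θ' x - realC v w θ x) ^ 2 * p x‖ ≤ (C * ‖θ' - θ‖) ^ 2 * P :=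
      fun x => by
        rw [Real.norm_eq_abs, abs_mul, abs_pow]
        have := abs_realC_sub_le v w θ θ' x
        gcongr
        exact hP x
    have := intervalIntegral.norm_integral_le_of_norm_le_const (a := a) (b := b)
      fun x _ => hb x
    rw [Real.norm_eq_abs] at this
    exact this.trans_eq (by ring)
  have hsum := (hT.add hE).add_const
    (riskC a b v w f p θ - 2 * ∫ x in a..b, realC v w θ x * residC v w f p θ x)
  refine (hsum.congr_fderiv ?_).congr_of_eventuallyEq (Eventually.of_forall fun θ' => ?_)
  · rw [add_zero, smul_add, smul_smul, Finset.smul_sum]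
    congr 1
    refine Finset.sum_congr rfl fun i _ => ?_
    rw [smul_smul, intervalIntegral_indicator_Ioo hab.le
      (le_add_of_nonneg_right (inv_pos.2 (hw i)).le) hr0, mul_assoc]
  · have c1 := (hN θ').mul hr
    have c2 := (((hN θ').sub (hN θ)).pow 2).mul hp
    have c3 := (((hN θ).sub hf).pow 2).mul hp
    have c4 := (hN θ).mul hr
    simp only [Pi.add_apply]
    rw [riskC_eq_intervalIntegral hab, riskC_eq_intervalIntegral hab,
      ← intervalIntegral.integral_const_mul, ← intervalIntegral.integral_const_mul,
      ← intervalIntegral.integral_add, ← intervalIntegral.integral_sub,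
      ← intervalIntegral.integral_add]
    · congr 1
      funext x
      simp only [residC]
      ring
    all_goals apply Continuous.intervalIntegrable; fun_prop

theorem hasFDerivAt_psiC {h : ℕ} (w : Fin h → ℝ) (θ : Fin (h + 1) → ℝ) (i : Fin h) :
    HasFDerivAt (fun θ' => psiC w θ' i) (-(w i)⁻¹ • coordL i.castSucc) θ := by
  have := (coordL i.castSucc : (Fin (h + 1) → ℝ) →L[ℝ] ℝ).hasFDerivAt (x := θ)
  refine (this.const_mul (-(w i)⁻¹)).congr_of_eventuallyEq (Eventually.of_forall fun θ' => ?_)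
  simp only [psiC, ContinuousLinearMap.proj_apply]
  ring

theorem exists_hasFDerivAt_integral_residC {h : ℕ} (v w : Fin h → ℝ)
    (hw : ∀ i, 0 < w i) {f p : ℝ → ℝ} (hf : Continuous f) (hp : Continuous p)
    {P : ℝ} (hP : ∀ x, |p x| ≤ P) (θ : Fin (h + 1) → ℝ) (i : Fin h) :
    ∃ D : (Fin (h + 1) → ℝ) →L[ℝ] ℝ,
      HasFDerivAt (fun θ' => ∫ x in psiC w θ' i..psiC w θ' i + (w i)⁻¹, residC v w f p θ' x) D θ ∧
      D (Pi.single i.castSucc 1) = v i * (∫ x in psiC w θ i..psiC w θ i + (w i)⁻¹, p x) -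
        (w i)⁻¹ * (residC v w f p θ (psiC w θ i + (w i)⁻¹) - residC v w f p θ (psiC w θ i)) := by
  set C := 1 + ∑ i, |v i| with hC
  have hC0 : 0 ≤ C := by positivity
  have hP0 : 0 ≤ P := (abs_nonneg _).trans (hP 0)
  have hN := continuous_realC v w
  have hg := continuous_residC v w hf hp
  set α := psiC w θ i with hα
  set β := α + (w i)⁻¹ with hβ
  have hαβ : α ≤ β := le_add_of_nonneg_right (inv_pos.2 (hw i)).le
  -- fixed integrand, moving end points
  have hΦ : ∀ u, HasDerivAt (fun u => ∫ x in (0 : ℝ)..u, residC v w f p θ x)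
      (residC v w f p θ u) u := fun u => ((hg θ).integral_hasStrictDerivAt 0 u).hasDerivAt
  have hψ := hasFDerivAt_psiC w θ i
  have hM := ((hΦ β).comp_hasFDerivAt θ (hψ.add_const (w i)⁻¹)).sub
    ((hΦ α).comp_hasFDerivAt θ hψ)
  -- moving integrand, fixed end points
  have hT := hasFDerivAt_integral_realC v w hw θ α β hp
  have hE : HasFDerivAt (fun θ' =>
      (∫ x in β..psiC w θ' i + (w i)⁻¹, (realC v w θ' x - realC v w θ x) * p x) -
        ∫ x in α..psiC w θ' i, (realC v w θ' x - realC v w θ x) * p x)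
      (0 : (Fin (h + 1) → ℝ) →L[ℝ] ℝ) θ := by
    have hb : ∀ θ' x, ‖(realC v w θ' x - realC v w θ x) * p x‖ ≤ C * ‖θ' - θ‖ * P :=
      fun θ' x => by
        rw [norm_mul]
        exact mul_le_mul (abs_realC_sub_le v w θ θ' x) (hP x) (norm_nonneg _) (by positivity)
    have hψ' : ∀ θ', |psiC w θ' i - α| ≤ (w i)⁻¹ * ‖θ' - θ‖ := fun θ' => by
      have e : psiC w θ' i - α = -((w i)⁻¹ * (θ' - θ) i.castSucc) := by
        rw [hα]
        simp only [psiC, Pi.sub_apply]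
        ring
      rw [e, abs_neg, abs_mul, abs_of_pos (inv_pos.2 (hw i))]
      exact mul_le_mul_of_nonneg_left (norm_le_pi_norm (θ' - θ) _) (inv_pos.2 (hw i)).le
    refine hasFDerivAt_zero_of_abs_le_sq (C := 2 * (C * P * (w i)⁻¹)) fun θ' => ?_
    refine (abs_sub _ _).trans ?_
    have h1 := intervalIntegral.norm_integral_le_of_norm_le_const
      (a := β) (b := psiC w θ' i + (w i)⁻¹) fun x _ => hb θ' x
    have h2 := intervalIntegral.norm_integral_le_of_norm_le_const
      (a := α) (b := psiC w θ' i) fun x _ => hb θ' x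
    rw [hβ, add_sub_add_right_eq_sub, ← hβ] at h1
    rw [Real.norm_eq_abs] at h1 h2
    have h3 := mul_le_mul_of_nonneg_left (hψ' θ')
      (show 0 ≤ C * ‖θ' - θ‖ * P by positivity)
    nlinarith [h1, h2, h3]
  have hS := ((hT.add hM).add hE).sub_const (∫ x in α..β, realC v w θ x * p x)
  refine ⟨_, hS.congr_of_eventuallyEq (Eventually.of_forall fun θ' => ?_), ?_⟩
  · simp only [Pi.add_apply, Pi.sub_apply, Function.comp_apply]
    have i1 : ∀ s t, IntervalIntegrable (residC v w f p θ) volume s t :=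
      fun s t => (hg θ).intervalIntegrable s t
    have i2 : ∀ θ' s t, IntervalIntegrable (fun x => realC v w θ' x * p x) volume s t :=
      fun θ' s t => ((hN θ').mul hp).intervalIntegrable s t
    have i3 : ∀ s t, IntervalIntegrable (fun x => f x * p x) volume s t :=
      fun s t => (hf.mul hp).intervalIntegrable s t
    simp only [residC, sub_mul]
    have i4 : ∀ θ' s t, ∫ x in s..t, (realC v w θ' x * p x - f x * p x) =
        (∫ x in s..t, realC v w θ' x * p x) - ∫ x in s..t, f x * p x :=
      fun θ' s t => intervalIntegral.integral_sub (i2 θ' s t) (i3 s t)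
    have i5 : ∀ s t, ∫ x in s..t, (realC v w θ' x * p x - realC v w θ x * p x) =
        (∫ x in s..t, realC v w θ' x * p x) - ∫ x in s..t, realC v w θ x * p x :=
      fun s t => intervalIntegral.integral_sub (i2 θ' s t) (i2 θ s t)
    simp only [i4, i5]
    have j : ∀ {q : ℝ → ℝ}, (∀ s t, IntervalIntegrable q volume s t) → ∀ s t,
        ∫ x in s..t, q x = (∫ x in (0 : ℝ)..t, q x) - ∫ x in (0 : ℝ)..s, q x :=
      fun hq s t => (intervalIntegral.integral_interval_sub_left (hq _ _) (hq _ _)).symm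
    rw [j (i2 θ') (psiC w θ' i), j i3 (psiC w θ' i), j (i2 θ') α, j (i2 θ') β, j (i2 θ) β,
      j (i2 θ) α (psiC w θ' i), j (i2 θ') α (psiC w θ' i), j (i2 θ) α β]
    ring
  · have hs : ∀ j : Fin h, (∫ x in α..β, (Set.Ioo (psiC w θ j) (psiC w θ j + (w j)⁻¹)).indicator
        p x) * (Pi.single i.castSucc (1 : ℝ) : Fin (h + 1) → ℝ) j.castSucc =
          if j = i then ∫ x in α..β, p x else 0 := by
      intro j
      split_ifs with hji
      · subst hji
        rw [Pi.single_eq_same, mul_one, intervalIntegral.integral_of_le hαβ,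
          intervalIntegral.integral_of_le hαβ, integral_Ioc_eq_integral_Ioo,
          integral_Ioc_eq_integral_Ioo]
        exact setIntegral_congr_fun measurableSet_Ioo fun x hx => Set.indicator_of_mem hx _
      · rw [Pi.single_eq_of_ne, mul_zero]
        simpa using hji
    have hl : (Pi.single i.castSucc (1 : ℝ) : Fin (h + 1) → ℝ) (Fin.last h) = 0 :=
      Pi.single_eq_of_ne (Fin.castSucc_lt_last i).ne' _
    simp only [add_apply, sub_apply,
      smul_apply, sum_apply,
      ContinuousLinearMap.proj_apply, zero_apply, smul_eq_mul, mul_assoc, hs,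
      hl, Pi.single_eq_same, mul_ite, mul_zero, Finset.sum_ite_eq', Finset.mem_univ, if_true]
    ring

theorem gradient_and_hessian_diag_riskC {h : ℕ} {a b : ℝ} (hab : a < b) (v w : Fin h → ℝ)
    (hv : ∀ i, 0 < v i) (hw : ∀ i, 0 < w i) {f p : ℝ → ℝ} (hf : Continuous f)
    (hp : Continuous p) (hp0 : ∀ x ∉ Set.Ioo a b, p x = 0) {P : ℝ} (hP : ∀ x, |p x| ≤ P)
    {θ : Fin (h + 1) → ℝ} (hcrit : fderiv ℝ (riskC a b v w f p) θ = 0)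
    (hdesc : ¬ IsDescCrit (riskC a b v w f p) θ) (i : Fin h) :
    (∫ x in psiC w θ i..psiC w θ i + (w i)⁻¹, residC v w f p θ x) = 0 ∧
      residC v w f p θ (psiC w θ i + (w i)⁻¹) - residC v w f p θ (psiC w θ i) ≤
        v i * w i * ∫ x in psiC w θ i..psiC w θ i + (w i)⁻¹, p x := by
  have hs : ∀ j : Fin h, (Pi.single i.castSucc (1 : ℝ) : Fin (h + 1) → ℝ) j.castSucc =
      if j = i then 1 else 0 := by
    intro j
    simp [Pi.single_apply]
  have hl : (Pi.single i.castSucc (1 : ℝ) : Fin (h + 1) → ℝ) (Fin.last h) = 0 :=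
    Pi.single_eq_of_ne (Fin.castSucc_lt_last i).ne' _
  have hL := hasFDerivAt_riskC hab v w hw hf hp hp0 hP
  constructor
  · have h0 := congrArg (fun D => D (Pi.single i.castSucc 1)) ((hL θ).fderiv.symm.trans hcrit)
    simp only [add_apply, smul_apply,
      sum_apply, ContinuousLinearMap.proj_apply,
      zero_apply, smul_eq_mul, hs, hl, mul_ite, mul_zero, mul_one,
      Finset.sum_ite_eq', Finset.mem_univ, if_true, zero_add] at h0
    have := hv i
    rcases mul_eq_zero.1 h0 with h0 | h0
    · linarith
    · exact h0
  · choose D hD hDi using fun j => exists_hasFDerivAt_integral_residC v w hw hf hp hP θ j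
    have hlast : HasFDerivAt (fun θ' => ∫ x in a..b, residC v w f p θ' x)
        ((∫ x in a..b, p x) • coordL (Fin.last h) + ∑ i, (v i * ∫ x in a..b,
        (Set.Ioo (psiC w θ i) (psiC w θ i + (w i)⁻¹)).indicator p x) • coordL i.castSucc) θ := by
      refine ((hasFDerivAt_integral_realC v w hw θ a b hp).sub_const
        (∫ x in a..b, f x * p x)).congr_of_eventuallyEq (Eventually.of_forall fun θ' => ?_)
      simp only [residC, sub_mul]
      exact intervalIntegral.integral_sub
        (((continuous_realC v w θ').mul hp).intervalIntegrable _ _)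
        ((hf.mul hp).intervalIntegrable _ _)
    have hLL := ((hlast.const_mul 2).smul_const (coordL (Fin.last h))).add
      (HasFDerivAt.fun_sum (u := Finset.univ) fun j _ =>
        ((hD j).const_mul (2 * v j)).smul_const (coordL j.castSucc))
    have hff : fderiv ℝ (riskC a b v w f p) = fun θ' =>
      ((2 * ∫ x in a..b, residC v w f p θ' x) • coordL (Fin.last h) +
        ∑ i, (2 * v i * ∫ x in psiC w θ' i..psiC w θ' i + (w i)⁻¹, residC v w f p θ' x) •
          coordL i.castSucc) := funext fun θ' => (hL θ').fderiv
    have hnn : 0 ≤ iteratedFDeriv ℝ 2 (riskC a b v w f p) θ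
        ![Pi.single i.castSucc 1, Pi.single i.castSucc 1] := by
      by_contra! hneg
      exact hdesc ⟨hcrit, _, hneg⟩
    rw [iteratedFDeriv_two_apply, hff] at hnn
    erw [hLL.fderiv] at hnn
    simp only [Matrix.cons_val_zero, Matrix.cons_val_one, add_apply,
      ContinuousLinearMap.smulRight_apply, smul_apply,
      sum_apply, ContinuousLinearMap.proj_apply, smul_eq_mul, hs, hl,
      mul_ite, mul_zero, mul_one, Finset.sum_ite_eq', Finset.mem_univ, if_true, zero_add,
      hDi] at hnn
    have hvi := hv i
    have h2 := nonneg_of_mul_nonneg_right hnn (by positivity)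
    have h3 := mul_le_mul_of_nonneg_left (sub_nonneg.1 h2) (hw i).le
    rw [mul_inv_cancel_left₀ (hw i).ne'] at h3
    linarith

theorem neg_and_pos_of_integral_mul_eq_zero {F p : ℝ → ℝ} (hF : Continuous F)
    (hp : Continuous p) {l r : ℝ} (hlr : l < r) (hppos : ∀ x ∈ Set.Ioo l r, 0 < p x)
    (hmono : StrictMonoOn F (Set.Icc l r)) (hint : ∫ x in l..r, F x * p x = 0) :
    F l < 0 ∧ 0 < F r := by
  have hl := Set.left_mem_Icc.2 hlr.le
  have hr := Set.right_mem_Icc.2 hlr.le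
  constructor
  · by_contra! h0
    refine (intervalIntegral.intervalIntegral_pos_of_pos_on
      ((hF.mul hp).intervalIntegrable l r) (fun x hx => ?_) hlr).ne' hint
    exact mul_pos (h0.trans_lt (hmono hl (Set.Ioo_subset_Icc_self hx) hx.1)) (hppos x hx)
  · by_contra! h0
    have := intervalIntegral.intervalIntegral_pos_of_pos_on
      ((hF.mul hp).neg.intervalIntegrable l r) (fun x hx => neg_pos.2 ?_) hlr
    · have e := intervalIntegral.integral_neg (μ := volume) (a := l) (b := r)
        (f := fun x => F x * p x)
      exact (this.trans_eq (e.trans (by rw [hint, neg_zero]))).false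
    · exact mul_neg_of_neg_of_pos
        ((hmono (Set.Ioo_subset_Icc_self hx) hr hx.2).trans_le h0) (hppos x hx)

theorem strictMonoOn_of_slope_le {F : ℝ → ℝ} {s : Set ℝ} {σ : ℝ} (hσ : 0 < σ)
    (hslope : ∀ x ∈ s, ∀ y ∈ s, x ≤ y → σ * (y - x) ≤ F y - F x) : StrictMonoOn F s :=
  fun x hx y hy hxy => by
    have h1 := hslope x hx y hy hxy.le
    have h2 := mul_pos hσ (sub_pos.2 hxy)
    linarith

theorem mul_integral_le_of_monotoneOn {F p : ℝ → ℝ} (hF : Continuous F) (hp : Continuous p)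
    {l r σ : ℝ} (hlr : l < r) (hσ : 0 < σ) (hp0 : ∀ x, 0 ≤ p x)
    (hppos : ∀ x ∈ Set.Ioo l r, 0 < p x)
    (hslope : ∀ x ∈ Set.Icc l r, ∀ y ∈ Set.Icc l r, x ≤ y → σ * (y - x) ≤ F y - F x)
    (hint : ∫ x in l..r, F x * p x = 0) (hpm : MonotoneOn p (Set.Icc l r)) :
    σ * ∫ x in l..r, p x ≤ 3 * (F r * p r) := by
  have hmono := strictMonoOn_of_slope_le hσ hslope
  have hl := Set.left_mem_Icc.2 hlr.le
  have hr := Set.right_mem_Icc.2 hlr.le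
  obtain ⟨hFl, hFr⟩ := neg_and_pos_of_integral_mul_eq_zero hF hp hlr hppos hmono hint
  obtain ⟨z, hz, hFz⟩ : (0 : ℝ) ∈ F '' Set.Ioo l r :=
    intermediate_value_Ioo hlr.le hF.continuousOn ⟨hFl, hFr⟩
  have ip : ∀ s t, IntervalIntegrable p volume s t := fun s t => hp.intervalIntegrable s t
  have ig : ∀ s t, IntervalIntegrable (fun x => F x * p x) volume s t :=
    fun s t => (hF.mul hp).intervalIntegrable s t
  have hzI := Set.Ioo_subset_Icc_self hz
  have hpr := hp0 r
  have hsr : σ * (r - z) ≤ F r := by simpa [hFz] using hslope z hzI r hr hz.2.le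
  have hΦ := mul_le_mul_of_nonneg_right hsr hpr
  -- integrals of `p` over subintervals
  have hlen : ∀ s t, l ≤ s → s ≤ t → t ≤ r → ∫ x in s..t, p x ≤ (t - s) * p r := by
    intro s t hs hst ht
    have := intervalIntegral.integral_mono_on hst (ip s t)
      (intervalIntegrable_const (c := p r)) fun x hx =>
        hpm ⟨hs.trans hx.1, hx.2.trans ht⟩ hr (hx.2.trans ht)
    simpa using this
  by_cases hc : z - l ≤ r - z
  · have h1 := hlen l r le_rfl hlr.le le_rfl
    have h2 := mul_le_mul_of_nonneg_left h1 hσ.le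
    nlinarith [mul_nonneg (mul_nonneg hσ.le (sub_nonneg.2 hc)) hpr,
      mul_nonneg hFr.le hpr]
  · set y := z - (r - z) with hy
    have hyl : l ≤ y := by linarith
    have hyz : y ≤ z := by linarith [hz.2]
    have hyI : y ∈ Set.Icc l r := ⟨hyl, hyz.trans hz.2.le⟩
    have hsy : σ * (r - z) ≤ -F y := by
      have := hslope y hyI z hzI hyz
      rw [hFz, hy] at this
      linarith
    have hX : σ * (r - z) * ∫ x in l..y, p x ≤ -∫ x in l..y, F x * p x := by
      rw [← intervalIntegral.integral_const_mul, ← intervalIntegral.integral_neg]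
      refine intervalIntegral.integral_mono_on hyl ((hp.const_mul _).intervalIntegrable _ _)
        ((hF.mul hp).neg.intervalIntegrable _ _) fun x hx => ?_
      rw [← neg_mul]
      refine mul_le_mul_of_nonneg_right (hsy.trans (neg_le_neg ?_)) (hp0 x)
      exact hmono.monotoneOn ⟨hx.1, hx.2.trans hyI.2⟩ hyI hx.2
    have hY : ∫ x in y..z, F x * p x ≤ 0 := by
      have := intervalIntegral.integral_mono_on hyz (ig y z)
        (intervalIntegrable_const (c := (0 : ℝ))) fun x hx =>
          mul_nonpos_of_nonpos_of_nonneg (hFz ▸ hmono.monotoneOn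
            ⟨hyl.trans hx.1, hx.2.trans hz.2.le⟩ hzI hx.2) (hp0 x)
      simpa using this
    have hZ : ∫ x in z..r, F x * p x ≤ (r - z) * (F r * p r) := by
      have := intervalIntegral.integral_mono_on hz.2.le (ig z r)
        (intervalIntegrable_const (c := F r * p r)) fun x hx => by
          have hxI : x ∈ Set.Icc l r := ⟨hz.1.le.trans hx.1, hx.2⟩
          exact mul_le_mul (hmono.monotoneOn hxI hr hx.2) (hpm hxI hr hx.2) (hp0 x) hFr.le
      rwa [intervalIntegral.integral_const, smul_eq_mul] at this
    have e1 := intervalIntegral.integral_add_adjacent_intervals (ig l y) (ig y z)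
    have e2 := intervalIntegral.integral_add_adjacent_intervals (ig l z) (ig z r)
    have e3 := intervalIntegral.integral_add_adjacent_intervals (ip l y) (ip y r)
    have h3 : (r - z) * (σ * ∫ x in l..y, p x) ≤ (r - z) * (F r * p r) := by linarith
    have h4 := le_of_mul_le_mul_left h3 (sub_pos.2 hz.2)
    have h5 := mul_le_mul_of_nonneg_left (hlen y r hyl hyI.2 le_rfl) hσ.le
    rw [← e3, mul_add]
    have e4 : σ * ((r - y) * p r) = 2 * (σ * (r - z) * p r) := by rw [hy]; ring
    linarith

theorem mul_integral_le_of_antitoneOn {F p : ℝ → ℝ} (hF : Continuous F) (hp : Continuous p)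
    {l r σ : ℝ} (hlr : l < r) (hσ : 0 < σ) (hp0 : ∀ x, 0 ≤ p x)
    (hppos : ∀ x ∈ Set.Ioo l r, 0 < p x)
    (hslope : ∀ x ∈ Set.Icc l r, ∀ y ∈ Set.Icc l r, x ≤ y → σ * (y - x) ≤ F y - F x)
    (hint : ∫ x in l..r, F x * p x = 0) (hpm : AntitoneOn p (Set.Icc l r)) :
    σ * ∫ x in l..r, p x ≤ 3 * -(F l * p l) := by
  have hI : ∀ x ∈ Set.Icc (-r) (-l), -x ∈ Set.Icc l r :=
    fun x hx => ⟨by linarith [hx.2], by linarith [hx.1]⟩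
  have := mul_integral_le_of_monotoneOn (F := fun x => -F (-x)) (p := fun x => p (-x))
    (hF.comp continuous_neg).neg (hp.comp continuous_neg) (neg_lt_neg hlr) hσ
    (fun x => hp0 _) (fun x hx => hppos _ ⟨by linarith [hx.2], by linarith [hx.1]⟩)
    (fun x hx y hy hxy => by
      have := hslope (-y) (hI y hy) (-x) (hI x hx) (neg_le_neg hxy)
      linarith)
    (by
      have := intervalIntegral.integral_comp_neg (a := -r) (b := -l) fun x => -F x * p x
      simp only [neg_mul, neg_neg, intervalIntegral.integral_neg, hint] at this
      simpa using this)
    (fun x hx y hy hxy => hpm (hI y hy) (hI x hx) (neg_le_neg hxy))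
  simpa [intervalIntegral.integral_comp_neg] using this

theorem mul_integral_le_of_le_two_mul {F p : ℝ → ℝ} (hp : Continuous p)
    {l r σ : ℝ} (hlr : l < r) (hp0 : ∀ x, 0 ≤ p x) (hFl : F l ≤ 0) (hFr : 0 ≤ F r)
    (hslope : σ * (r - l) ≤ F r - F l)
    (hp2 : ∀ x ∈ Set.Icc l r, p x ≤ 2 * p l ∧ p x ≤ 2 * p r) :
    σ * ∫ x in l..r, p x ≤ 3 * (F r * p r - F l * p l) := by
  have h1 : σ * (r - l) * ∫ x in l..r, p x ≤ (r - l) * (2 * (F r * p r - F l * p l)) := by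
    have := intervalIntegral.integral_mono_on (μ := volume) hlr.le
      ((hp.const_mul (σ * (r - l))).intervalIntegrable l r)
      (intervalIntegrable_const (c := 2 * (F r * p r - F l * p l))) fun x hx => by
        have h1 := mul_le_mul_of_nonneg_right hslope (hp0 x)
        have h2 := mul_le_mul_of_nonneg_left (hp2 x hx).2 hFr
        have h3 := mul_le_mul_of_nonneg_left (hp2 x hx).1 (neg_nonneg.2 hFl)
        linarith
    rwa [intervalIntegral.integral_const_mul, intervalIntegral.integral_const, smul_eq_mul] at this
  have h2 : (r - l) * (σ * ∫ x in l..r, p x) ≤ (r - l) * (2 * (F r * p r - F l * p l)) := by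
    linarith
  have h3 := le_of_mul_le_mul_left h2 (sub_pos.2 hlr)
  have h4 := mul_nonneg hFr (hp0 r)
  have h5 := mul_nonneg (neg_nonneg.2 hFl) (hp0 l)
  linarith

theorem sum_mul_sub_le_realC_sub {h : ℕ} {v w : Fin h → ℝ} (hv : ∀ i, 0 < v i)
    (hw : ∀ i, 0 < w i) (θ : Fin (h + 1) → ℝ) (S : Finset (Fin h)) {x y : ℝ} (hxy : x ≤ y)
    (hx : ∀ i ∈ S, psiC w θ i ≤ x) (hy : ∀ i ∈ S, y ≤ psiC w θ i + (w i)⁻¹) :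
    (∑ i ∈ S, v i * w i) * (y - x) ≤ realC v w θ y - realC v w θ x := by
  have e : realC v w θ y - realC v w θ x =
      ∑ i, v i * (clipFn (w i * y + θ i.castSucc) - clipFn (w i * x + θ i.castSucc)) := by
    simp only [realC, mul_sub, Finset.sum_sub_distrib]
    ring
  have hc : ∀ i ∈ S, ∀ u, x ≤ u → u ≤ y → clipFn (w i * u + θ i.castSucc) =
      w i * u + θ i.castSucc := by
    intro i hi u hxu huy
    have h1 := (hx i hi).trans hxu
    have h2 := huy.trans (hy i hi)
    have hwi := hw i
    have e2 : psiC w θ i + (w i)⁻¹ = (1 - θ i.castSucc) / w i := by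
      rw [psiC]
      field_simp
      ring
    rw [psiC, div_le_iff₀ hwi] at h1
    rw [e2, le_div_iff₀ hwi] at h2
    exact clipFn_of_mem ⟨by linarith, by linarith⟩
  rw [e, Finset.sum_mul]
  calc ∑ i ∈ S, v i * w i * (y - x)
      = ∑ i ∈ S, v i * (clipFn (w i * y + θ i.castSucc) - clipFn (w i * x + θ i.castSucc)) :=
        Finset.sum_congr rfl fun i hi => by
          rw [hc i hi y hxy le_rfl, hc i hi x le_rfl hxy]
          ring
    _ ≤ _ := Finset.sum_le_sum_of_subset_of_nonneg (Finset.subset_univ S) fun i _ _ =>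
        mul_nonneg (hv i).le (sub_nonneg.2 (monotone_clipFn
          (add_le_add_left (mul_le_mul_of_nonneg_left hxy (hw i).le) _)))

theorem intervalIntegral_clip_endpoints {a b α β : ℝ} (hab : a ≤ b) (hαβ : α ≤ β)
    (hlr : max α a ≤ min β b) {q : ℝ → ℝ} (hq : ∀ x ∉ Set.Ioo a b, q x = 0) :
    ∫ x in α..β, q x = ∫ x in max α a..min β b, q x := by
  rw [← intervalIntegral_indicator_Ioo hab hαβ hq, ← intervalIntegral_indicator_Ioo hab hlr hq]
  congr 1
  funext x
  by_cases hx : x ∈ Set.Ioo a b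
  · rw [← Set.Ioo_inter_Ioo, ← Set.indicator_indicator]
    simp [Set.indicator_apply, hx.1, hx.2]
  · simp [Set.indicator_apply, hq x hx]

open scoped Classical in
theorem statement_5
    (a b : ℝ) (hab : a < b) (h : ℕ) (hh : 0 < h)
    (v w : Fin h → ℝ) (hv : ∀ i, 0 < v i) (hw : ∀ i, 0 < w i)
    (f p : ℝ → ℝ) (hf : Continuous f) (hp : Continuous p)
    (hpnn : ∀ x : ℝ, 0 ≤ p x) (hsupp : {x : ℝ | 0 < p x} = Set.Ioo a b)
    -- `Lip(f) < min_i v_i w_i`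
    (K : ℝ) (hK : ∀ i, K < v i * w i)
    (hLipf : ∀ x ∈ Set.Icc a b, ∀ y ∈ Set.Icc a b, |f x - f y| ≤ K * |x - y|)
    (θ : Fin (h + 1) → ℝ) (hcrit : fderiv ℝ (riskC a b v w f p) θ = 0)
    (ε δ : ℝ) (hε : 0 < ε) (hδ : 0 < δ)
    (hεδ : 2 * (⨅ j, w j)⁻¹ < ε - δ)
    -- `inf_{x ∈ [a+δ, b-δ]} p(x) ≥ (min_j w_j)⁻¹ Lip(p)`
    (Kp : ℝ) (hLipp : ∀ x ∈ Set.Icc a b, ∀ y ∈ Set.Icc a b, |p x - p y| ≤ Kp * |x - y|)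
    (hinf : ∀ x ∈ Set.Icc (a + δ) (b - δ), (⨅ j, w j)⁻¹ * Kp ≤ p x)
    (hmono : StrictMonoOn p (Set.Icc a (a + ε)))
    (hanti : StrictAntiOn p (Set.Icc (b - ε) b))
    (hdesc : ¬ IsDescCrit (riskC a b v w f p) θ) :
    ∀ x ∈ Set.Ioo a b,
      ∀ hS : (Finset.univ.filter fun j => x ∈ actI a b w θ j).Nonempty,
        ∑ j ∈ Finset.univ.filter (fun j => x ∈ actI a b w θ j), v j * w j ≤
          4 * (Finset.univ.filter fun j => x ∈ actI a b w θ j).sup' hS fun j => v j * w j := by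
  intro x hx hS
  have hp0 : ∀ y ∉ Set.Ioo a b, p y = 0 := fun y hy => by
    rw [← hsupp] at hy
    exact le_antisymm (not_lt.1 hy) (hpnn y)
  have hppos : ∀ y ∈ Set.Ioo a b, 0 < p y := fun y hy => by rwa [← hsupp] at hy
  have hKp : 0 ≤ Kp := by
    have := (abs_nonneg _).trans (hLipp b ⟨hab.le, le_rfl⟩ a ⟨le_rfl, hab.le⟩)
    rw [abs_of_pos (sub_pos.2 hab)] at this
    exact nonneg_of_mul_nonneg_left this (sub_pos.2 hab)
  obtain ⟨P, hP⟩ : ∃ P, ∀ y, |p y| ≤ P := by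
    obtain ⟨P, hP⟩ := isCompact_Icc.exists_bound_of_continuousOn
      (hp.continuousOn (s := Set.Icc a b))
    refine ⟨max P 0, fun y => ?_⟩
    by_cases hy : y ∈ Set.Ioo a b
    · exact (hP y (Set.Ioo_subset_Icc_self hy)).trans (le_max_left _ _)
    · rw [hp0 y hy, abs_zero]
      exact le_max_right _ _
  set W := (⨅ j, w j)⁻¹ with hW
  have hwW : ∀ i, (w i)⁻¹ ≤ W := fun i => by
    have : Nonempty (Fin h) := ⟨i⟩
    obtain ⟨j, hj⟩ := exists_eq_ciInf_of_finite (f := w)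
    exact inv_anti₀ (hj ▸ hw j) (ciInf_le (Set.finite_range w).bddBelow i)
  set S := Finset.univ.filter fun j => x ∈ actI a b w θ j with hSdef
  by_contra! hcon
  -- the clipped activity intervals `(l i, r i)`
  set l : Fin h → ℝ := fun i => max (psiC w θ i) a with hl
  set r : Fin h → ℝ := fun i => min (psiC w θ i + (w i)⁻¹) b with hr
  have hlx : ∀ i ∈ S, l i < x := fun i hi =>
    max_lt (Finset.mem_filter.1 hi).2.1.1 hx.1
  have hxr : ∀ i ∈ S, x < r i := fun i hi =>
    lt_min (Finset.mem_filter.1 hi).2.1.2 hx.2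
  have hla : ∀ i, a ≤ l i := fun i => le_max_right _ _
  have hrb : ∀ i, r i ≤ b := fun i => min_le_right _ _
  have hrl : ∀ i, r i - l i ≤ W := fun i => by
    have h1 : psiC w θ i ≤ l i := le_max_left _ _
    have h2 : r i ≤ psiC w θ i + (w i)⁻¹ := min_le_left _ _
    linarith [hwW i]
  set F : ℝ → ℝ := fun y => realC v w θ y - f y with hFdef
  have hF : Continuous F := (continuous_realC v w θ).sub hf
  have hslope : ∀ T : Finset (Fin h), ∀ y z, a ≤ y → z ≤ b → y ≤ z → (∀ i ∈ T, l i ≤ y) →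
      (∀ i ∈ T, z ≤ r i) → (∑ i ∈ T, v i * w i - K) * (z - y) ≤ F z - F y := by
    intro T y z hy hz hyz hTy hTz
    have h1 := sum_mul_sub_le_realC_sub hv hw θ T hyz
      (fun i hi => (le_max_left _ _).trans (hTy i hi))
      (fun i hi => (hTz i hi).trans (min_le_left _ _))
    have h2 := (le_abs_self _).trans (hLipf z ⟨hy.trans hyz, hz⟩ y ⟨hy, hyz.trans hz⟩)
    rw [abs_of_nonneg (sub_nonneg.2 hyz)] at h2
    simp only [hFdef]
    linarith
  have hmonoF : ∀ i, StrictMonoOn F (Set.Icc (l i) (r i)) := fun i =>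
    strictMonoOn_of_slope_le (sub_pos.2 (hK i)) fun y hy z hz hyz => by
      simpa using hslope {i} y z ((hla i).trans hy.1) (hz.2.trans (hrb i)) hyz
        (by simpa using hy.1) (by simpa using hz.2)
  have hpos : ∀ i, ∀ y ∈ Set.Ioo (l i) (r i), 0 < p y := fun i y hy =>
    hppos y ⟨(hla i).trans_lt hy.1, hy.2.trans_le (hrb i)⟩
  -- first and second order conditions on the clipped intervals
  have hg0 : ∀ y ∉ Set.Ioo a b, F y * p y = 0 := fun y hy => by rw [hp0 y hy, mul_zero]
  have hcond : ∀ i ∈ S, (∫ y in l i..r i, F y * p y) = 0 ∧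
      F (r i) * p (r i) - F (l i) * p (l i) ≤ v i * w i * ∫ y in l i..r i, p y := by
    intro i hi
    have hlr := ((hlx i hi).trans (hxr i hi)).le
    have hαβ : psiC w θ i ≤ psiC w θ i + (w i)⁻¹ :=
      le_add_of_nonneg_right (inv_pos.2 (hw i)).le
    obtain ⟨h1, h2⟩ := gradient_and_hessian_diag_riskC hab v w hv hw hf hp hp0 hP hcrit hdesc i
    change (∫ y in psiC w θ i..psiC w θ i + (w i)⁻¹, F y * p y) = 0 at h1
    change F _ * p _ - F _ * p _ ≤ _ at h2
    rw [intervalIntegral_clip_endpoints hab.le hαβ hlr hg0] at h1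
    rw [intervalIntegral_clip_endpoints hab.le hαβ hlr hp0] at h2
    refine ⟨h1, ?_⟩
    have e1 : F (r i) * p (r i) =
        F (psiC w θ i + (w i)⁻¹) * p (psiC w θ i + (w i)⁻¹) := by
      rcases le_total (psiC w θ i + (w i)⁻¹) b with hb | hb
      · simp only [hr, min_eq_left hb]
      · simp only [hr, min_eq_right hb]
        rw [hg0 b (fun hy => hy.2.false), hg0 _ fun hy => (hy.2.trans_le hb).false]
    have e2 : F (l i) * p (l i) = F (psiC w θ i) * p (psiC w θ i) := by
      rcases le_total a (psiC w θ i) with ha | ha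
      · simp only [hl, max_eq_left ha]
      · simp only [hl, max_eq_right ha]
        rw [hg0 a (fun hy => hy.1.false), hg0 _ fun hy => (hy.1.trans_le ha).false]
    rw [e1, e2]
    exact h2
  have hsign : ∀ i ∈ S, F (l i) < 0 ∧ 0 < F (r i) := fun i hi =>
    neg_and_pos_of_integral_mul_eq_zero hF hp ((hlx i hi).trans (hxr i hi)) (hpos i)
      (hmonoF i) (hcond i hi).1
  -- the smallest right and the largest left end point belong to the same interval
  obtain ⟨i, hi, hri⟩ := Finset.exists_min_image S r hS
  obtain ⟨j, hj, hlj⟩ := Finset.exists_max_image S l hS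
  have hlij : l j = l i := by
    refine le_antisymm (not_lt.1 fun hlt => ?_) (hlj i hi)
    have ig : ∀ s t, IntervalIntegrable (fun y => F y * p y) volume s t :=
      fun s t => (hF.mul hp).intervalIntegrable s t
    have hjr : l j ≤ r i := ((hlx j hj).trans (hxr i hi)).le
    have h1 : 0 < ∫ y in l i..l j, -(F y * p y) := by
      refine intervalIntegral.intervalIntegral_pos_of_pos_on (ig _ _).neg (fun y hy => ?_) hlt
      refine neg_pos.2 (mul_neg_of_neg_of_pos ?_ (hpos i y ⟨hy.1, hy.2.trans_le hjr⟩))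
      exact (hmonoF i ⟨hy.1.le, (hy.2.trans_le hjr).le⟩ ⟨hlt.le, hjr⟩ hy.2).trans
        (hsign j hj).1
    have h2 : 0 ≤ ∫ y in r i..r j, F y * p y := by
      refine intervalIntegral.integral_nonneg (hri j hj) fun y hy => mul_nonneg ?_ (hpnn y)
      exact (hsign i hi).2.le.trans ((hmonoF j).monotoneOn ⟨hjr, hri j hj⟩
        ⟨hjr.trans hy.1, hy.2⟩ hy.1)
    rw [intervalIntegral.integral_neg] at h1
    have e1 := intervalIntegral.integral_add_adjacent_intervals (ig (l i) (l j)) (ig (l j) (r i))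
    have e2 := intervalIntegral.integral_add_adjacent_intervals (ig (l j) (r i)) (ig (r i) (r j))
    rw [(hcond i hi).1] at e1
    rw [(hcond j hj).1] at e2
    linarith
  have hlr := (hlx i hi).trans (hxr i hi)
  set σ := ∑ k ∈ S, v k * w k - K with hσ
  have hσμ : 3 * (v i * w i) < σ := by
    have := Finset.le_sup' (fun k => v k * w k) hi
    have := hK i
    linarith
  have hσ0 : 0 < σ := lt_trans (by have := hv i; have := hw i; positivity) hσμ
  have hsl : ∀ y ∈ Set.Icc (l i) (r i), ∀ z ∈ Set.Icc (l i) (r i), y ≤ z →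
      σ * (z - y) ≤ F z - F y := fun y hy z hz hyz =>
    hslope S y z ((hla i).trans hy.1) (hz.2.trans (hrb i)) hyz
      (fun k hk => (hlj k hk).trans (hlij.le.trans hy.1)) (fun k hk => hz.2.trans (hri k hk))
  have hFl := mul_nonneg (neg_nonneg.2 (hsign i hi).1.le) (hpnn (l i))
  have hFr := mul_nonneg (hsign i hi).2.le (hpnn (r i))
  have hW0 : 0 < W := (inv_pos.2 (hw i)).trans_le (hwW i)
  have hlen := hrl i
  have hkey : σ * ∫ y in l i..r i, p y ≤ 3 * (F (r i) * p (r i) - F (l i) * p (l i)) := by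
    rcases lt_or_ge (l i) (a + δ) with h1 | h1
    · have := mul_integral_le_of_monotoneOn hF hp hlr hσ0 hpnn (hpos i) hsl (hcond i hi).1
        (hmono.monotoneOn.mono (Set.Icc_subset_Icc (hla i) (by linarith)))
      linarith
    rcases lt_or_ge (b - δ) (r i) with h2 | h2
    · have := mul_integral_le_of_antitoneOn hF hp hlr hσ0 hpnn (hpos i) hsl (hcond i hi).1
        (hanti.antitoneOn.mono (Set.Icc_subset_Icc (by linarith) (hrb i)))
      linarith
    · have htwo : ∀ y ∈ Set.Icc (l i) (r i), ∀ z ∈ Set.Icc (l i) (r i), p y ≤ 2 * p z := by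
        intro y hy z hz
        have h3 := (le_abs_self _).trans (hLipp y ⟨(hla i).trans hy.1, hy.2.trans (hrb i)⟩ z
          ⟨(hla i).trans hz.1, hz.2.trans (hrb i)⟩)
        have h4 : |y - z| ≤ W :=
          abs_le.2 ⟨by linarith [hy.1, hz.2], by linarith [hy.2, hz.1]⟩
        have h5 := mul_le_mul_of_nonneg_left h4 hKp
        have h6 := hinf z ⟨h1.trans hz.1, hz.2.trans h2⟩
        linarith
      have hlI := Set.left_mem_Icc.2 hlr.le
      have hrI := Set.right_mem_Icc.2 hlr.le
      exact mul_integral_le_of_le_two_mul hp hlr hpnn (hsign i hi).1.le (hsign i hi).2.le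
        (hsl _ hlI _ hrI hlr.le) fun y hy => ⟨htwo y hy _ hlI, htwo y hy _ hrI⟩
  have hpint : 0 < ∫ y in l i..r i, p y :=
    intervalIntegral.intervalIntegral_pos_of_pos_on (hp.intervalIntegrable _ _) (hpos i) hlr
  have := mul_lt_mul_of_pos_right hσμ hpint
  have := (hcond i hi).2
  linarith
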